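/- arXiv:2104.01314 — 2 statements merged into one kernel-verified Lean document; each statement's English description precedes it below -/
import Mathlib

section
/- Assume f is μ_f-strongly convex with μ_f > 0, g* is merely convex (μ_{g*} = 0), a saddle point (x⋆, y⋆) of L exists, and g is M_g-Lipschitz continuous on dom g. Run ASGARD+ with τ₀ := 1, β₀ ≥ 0.382‖K‖²/μ_f, τ_{k+1} := (τ_k/2)(√(τ_k² + 4) − τ_k), β_{k+1} := β_k/(1+τ_{k+1}), L_k := ‖K‖²/β_k, m_{k+1} := (L_{k+1}+μ_f)/(L_k+μ_f), η_{k+1} := (1−τ_k)τ_k/(τ_k² + m_{k+1}τ_{k+1}). Then for all k ≥ 1, F(x^k) − F⋆ ≤ 2‖K‖²‖x⁰ − x⋆‖²/(β₀(k+1)²) + 10β₀(‖ẏ‖ + M_g)²/(k+3)². -/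
open RealInnerProductSpace Set

/-- Existence of a subgradient of a finite continuous convex function. -/
lemma aux_subgrad {E : Type*} [NormedAddCommGroup E] [InnerProductSpace ℝ E] [CompleteSpace E]
    (g : E → ℝ) (hg : ConvexOn ℝ univ g) (hc : Continuous g) (u : E) :
    ∃ v : E, ∀ w, g u + ⟪v, w - u⟫ ≤ g w := by
  have hconv := hg.convex_strict_epigraph
  have hopen : IsOpen {p : E × ℝ | p.1 ∈ univ ∧ g p.1 < p.2} := by
    simp only [mem_univ, true_and]
    exact isOpen_lt (hc.comp continuous_fst) continuous_snd
  obtain ⟨l, hl⟩ := geometric_hahn_banach_point_open (x := (u, g u)) hconv hopen (by simp)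
  have hadd : ∀ (w : E) (r : ℝ), l (w, r) = l (w, 0) + r * l (0, 1) := by
    intro w r
    have : ((w, r) : E × ℝ) = (w, 0) + r • (0, 1) := by simp
    rw [this, map_add, map_smul, smul_eq_mul]
  have hcpos : 0 < l ((0 : E), (1 : ℝ)) := by
    have h := hl (u, g u + 1) (by simp)
    rw [hadd u (g u), hadd u (g u + 1)] at h
    linarith
  set c := l ((0 : E), (1 : ℝ)) with hcdef
  let l1 : E →L[ℝ] ℝ := l.comp (ContinuousLinearMap.inl ℝ E ℝ)
  refine ⟨-(c⁻¹ • (InnerProductSpace.toDual ℝ E).symm l1), fun w => ?_⟩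
  have hin : ⟪-(c⁻¹ • (InnerProductSpace.toDual ℝ E).symm l1), w - u⟫
      = -(c⁻¹ * (l (w, 0) - l (u, 0))) := by
    rw [inner_neg_left, real_inner_smul_left, InnerProductSpace.toDual_symm_apply]
    simp [l1]
    left
    rw [← map_sub]
    simp
  rw [hin]
  refine le_of_forall_pos_le_add fun ε hε => ?_
  have h := hl (w, g w + ε) (by simpa using hε)
  rw [hadd u (g u), hadd w (g w + ε)] at h
  have h2 : c⁻¹ * (l (w, 0) - l (u, 0)) + (g w + ε - g u) > 0 := by
    have : c⁻¹ * (l (w, 0) - l (u, 0)) + (g w + ε - g u)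
      = c⁻¹ * ((l (w, 0) + (g w + ε) * c) - (l (u, 0) + g u * c)) := by
      field_simp
      ring
    rw [this]
    exact mul_pos (inv_pos.2 hcpos) (by linarith)
  linarith

/-- Convexity of a sum expands the squared norm. -/
lemma aux_normsq {E : Type*} [NormedAddCommGroup E] [InnerProductSpace ℝ E] (a b : E) (t : ℝ) :
    ‖(1 - t) • a + t • b‖ ^ 2 = (1 - t) * ‖a‖ ^ 2 + t * ‖b‖ ^ 2 - t * (1 - t) * ‖b - a‖ ^ 2 := by
  rw [norm_add_sq_real, norm_sub_sq_real, norm_smul, norm_smul, real_inner_smul_left,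
    real_inner_smul_right, mul_pow, mul_pow, Real.norm_eq_abs, Real.norm_eq_abs, sq_abs, sq_abs,
    real_inner_comm a b]
  ring

lemma aux_strong {E : Type*} [NormedAddCommGroup E] [InnerProductSpace ℝ E] {S : Set E}
    {f : E → ℝ} {μ : ℝ} (hf : ConvexOn ℝ S (fun x => f x - μ / 2 * ‖x‖ ^ 2))
    {a b : E} (ha : a ∈ S) (hb : b ∈ S) {t : ℝ} (h0 : 0 ≤ t) (h1 : t ≤ 1) :
    f ((1 - t) • a + t • b) ≤ (1 - t) * f a + t * f b - μ / 2 * (t * (1 - t)) * ‖b - a‖ ^ 2 := by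
  have h := hf.2 ha hb (sub_nonneg.2 h1) h0 (by ring)
  simp only [smul_eq_mul] at h
  rw [aux_normsq] at h
  nlinarith [h]

lemma aux_lim {a c : ℝ} (h : ∀ t : ℝ, 0 < t → t < 1 → c * (1 - t) ≤ a) : c ≤ a := by
  by_contra hlt
  push Not at hlt
  rcases le_or_gt c 0 with hc | hc
  · have := h (1/2) (by norm_num) (by norm_num)
    nlinarith
  · have hh := h (min (1/2) ((c - a) / (2 * c))) (lt_min (by norm_num) (div_pos (by linarith) (by linarith))) (by
      exact lt_of_le_of_lt (min_le_left _ _) (by norm_num))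
    have h3 : c * min (1/2) ((c - a) / (2 * c)) ≤ (c - a) / 2 := by
      calc _ ≤ c * ((c - a) / (2 * c)) := by gcongr; exact min_le_right _ _
        _ = _ := by field_simp
    linarith

/-- Quadratic growth of a strongly convex function at its minimizer. -/
lemma aux_min {E : Type*} [NormedAddCommGroup E] [InnerProductSpace ℝ E] {S : Set E}
    (hS : Convex ℝ S)
    {φ : E → ℝ} {μ : ℝ} (hf : ConvexOn ℝ S (fun x => φ x - μ / 2 * ‖x‖ ^ 2))
    {a b : E} (ha : a ∈ S) (hb : b ∈ S) (hmin : IsMinOn φ S a) :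
    φ a + μ / 2 * ‖b - a‖ ^ 2 ≤ φ b := by
  have : μ / 2 * ‖b - a‖ ^ 2 ≤ φ b - φ a := by
    apply aux_lim
    intro t h0 h1
    have h := aux_strong hf ha hb h0.le h1.le
    have h2 : φ a ≤ φ ((1 - t) • a + t • b) :=
      hmin (hS ha hb (sub_nonneg.2 h1.le) h0.le (by ring))
    have h3 : t * (μ / 2 * ‖b - a‖ ^ 2 * (1 - t)) ≤ t * (φ b - φ a) := by linarith
    exact le_of_mul_le_mul_left h3 h0
  linarith

lemma aux_affine_add {E : Type*} [NormedAddCommGroup E] [InnerProductSpace ℝ E] {S : Set E}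
    {φ : E → ℝ} {μ c : ℝ} (q z : E) (hf : ConvexOn ℝ S (fun x => φ x - μ / 2 * ‖x‖ ^ 2)) :
    ConvexOn ℝ S (fun x => (φ x + ⟪q, x⟫ + c / 2 * ‖x - z‖ ^ 2) - (μ + c) / 2 * ‖x‖ ^ 2) := by
  refine ⟨hf.1, fun a ha b hb s t hs ht hst => ?_⟩
  have h := hf.2 ha hb hs ht hst
  simp only [smul_eq_mul] at h ⊢
  have e : ∀ x : E, (φ x + ⟪q, x⟫ + c / 2 * ‖x - z‖ ^ 2) - (μ + c) / 2 * ‖x‖ ^ 2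
      = (φ x - μ / 2 * ‖x‖ ^ 2) + ⟪q, x⟫ - c * ⟪x, z⟫ + c / 2 * ‖z‖ ^ 2 := by
    intro x
    rw [norm_sub_sq_real]
    ring
  rw [e, e, e]
  simp only [inner_add_right, inner_add_left, real_inner_smul_left, real_inner_smul_right]
  have : t = 1 - s := by linarith
  subst this
  linarith

/-- One step inequality. -/
lemma aux_step {E F : Type*} [NormedAddCommGroup E] [InnerProductSpace ℝ E] [CompleteSpace E]
    [NormedAddCommGroup F] [InnerProductSpace ℝ F] [CompleteSpace F]
    {Sf : Set E} {Sg : Set F} {f : E → ℝ} {gs : F → ℝ} (K : E →L[ℝ] F) {μ β : ℝ} (hβ : 0 < β)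
    (hSf : Convex ℝ Sf) (hSg : Convex ℝ Sg)
    (hf : ConvexOn ℝ Sf (fun x => f x - μ / 2 * ‖x‖ ^ 2)) (hgs : ConvexOn ℝ Sg gs)
    (ydot : F) (xh xp : E) (yp : F) (hyp : yp ∈ Sg)
    (hy : IsMaxOn (fun z => ⟪K xh, z⟫ - gs z - β / 2 * ‖z - ydot‖ ^ 2) Sg yp)
    (hxp : xp ∈ Sf)
    (hx : IsMinOn (fun z => f z + ⟪(ContinuousLinearMap.adjoint K) yp, z⟫ +
        (‖K‖ ^ 2 / β) / 2 * ‖z - xh‖ ^ 2) Sf xp)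
    (w : E) (hw : w ∈ Sf) (z : F) (hz : z ∈ Sg) :
    f xp + ⟪K xp, z⟫ - gs z - β / 2 * ‖z - ydot‖ ^ 2 ≤
      f w + ⟪K w, yp⟫ - gs yp - β / 2 * ‖yp - ydot‖ ^ 2 + (‖K‖ ^ 2 / β) / 2 * ‖w - xh‖ ^ 2
        - (‖K‖ ^ 2 / β + μ) / 2 * ‖w - xp‖ ^ 2 := by
  have h1 := aux_min hSf (aux_affine_add ((ContinuousLinearMap.adjoint K) yp) xh hf) hxp hw hx
  simp only [ContinuousLinearMap.adjoint_inner_left] at h1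
  have hmin : IsMinOn (fun y => gs y + ⟪-(K xh), y⟫ + β / 2 * ‖y - ydot‖ ^ 2) Sg yp := by
    intro y hy'
    have := hy hy'
    simp only [mem_ofPred_eq, inner_neg_left] at this ⊢
    linarith
  have hgs' : ConvexOn ℝ Sg (fun y => gs y - (0 : ℝ) / 2 * ‖y‖ ^ 2) := by simpa using hgs
  have h2 := aux_min hSg (aux_affine_add (-(K xh)) ydot hgs') hyp hz hmin
  simp only [inner_neg_left, zero_add] at h2
  have h3 : ⟪K (xp - xh), z - yp⟫ ≤ β / 2 * ‖z - yp‖ ^ 2 + (‖K‖ ^ 2 / β) / 2 * ‖xp - xh‖ ^ 2 := by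
    have a1 := real_inner_le_norm (K (xp - xh)) (z - yp)
    have a2 : ‖K (xp - xh)‖ * ‖z - yp‖ ≤ (‖K‖ * ‖xp - xh‖) * ‖z - yp‖ := by
      gcongr
      exact K.le_opNorm _
    have a3 : (‖K‖ * ‖xp - xh‖) * ‖z - yp‖ ≤
        β / 2 * ‖z - yp‖ ^ 2 + (‖K‖ ^ 2 / β) / 2 * ‖xp - xh‖ ^ 2 := by
      have : β / 2 * ‖z - yp‖ ^ 2 + (‖K‖ ^ 2 / β) / 2 * ‖xp - xh‖ ^ 2
          - (‖K‖ * ‖xp - xh‖) * ‖z - yp‖ = (β * ‖z - yp‖ - ‖K‖ * ‖xp - xh‖) ^ 2 / (2 * β) := by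
        field_simp
        ring
      have h0 : 0 ≤ (β * ‖z - yp‖ - ‖K‖ * ‖xp - xh‖) ^ 2 / (2 * β) := by positivity
      linarith
    linarith
  have e1 : ⟪K (xp - xh), z - yp⟫ = ⟪K xp, z⟫ - ⟪K xh, z⟫ - ⟪K xp, yp⟫ + ⟪K xh, yp⟫ := by
    rw [map_sub, inner_sub_left, inner_sub_right, inner_sub_right]
    ring
  rw [e1] at h3
  have e2 : ⟪yp, K xp⟫ = ⟪K xp, yp⟫ := real_inner_comm _ _
  have e3 : ⟪yp, K w⟫ = ⟪K w, yp⟫ := real_inner_comm _ _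
  rw [e2, e3] at h1
  linarith

/-- Weighted Cauchy-Schwarz. -/
lemma aux_cs {E : Type*} [NormedAddCommGroup E] [InnerProductSpace ℝ E] (a b : E)
    {P Q A B c : ℝ} (hA : 0 < A) (hB : 0 < B) (hc : 0 ≤ c)
    (h : c * (P ^ 2 * A + Q ^ 2 * B) ≤ A * B) :
    c * ‖P • a + Q • b‖ ^ 2 ≤ B * ‖a‖ ^ 2 + A * ‖b‖ ^ 2 := by
  have e : A * B * ‖P • a + Q • b‖ ^ 2 + ‖(B * Q) • a - (A * P) • b‖ ^ 2
      = (P ^ 2 * A + Q ^ 2 * B) * (B * ‖a‖ ^ 2 + A * ‖b‖ ^ 2) := by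
    rw [norm_add_sq_real, norm_sub_sq_real]
    simp only [norm_smul, real_inner_smul_left, real_inner_smul_right, mul_pow,
      Real.norm_eq_abs, sq_abs]
    ring
  have hAB : 0 < A * B := mul_pos hA hB
  have h1 : A * B * ‖P • a + Q • b‖ ^ 2
      ≤ (P ^ 2 * A + Q ^ 2 * B) * (B * ‖a‖ ^ 2 + A * ‖b‖ ^ 2) := by
    nlinarith [sq_nonneg ‖(B * Q) • a - (A * P) • b‖]
  have h2 : c * (A * B * ‖P • a + Q • b‖ ^ 2) ≤ A * B * (B * ‖a‖ ^ 2 + A * ‖b‖ ^ 2) := by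
    calc _ ≤ c * ((P ^ 2 * A + Q ^ 2 * B) * (B * ‖a‖ ^ 2 + A * ‖b‖ ^ 2)) := by gcongr
      _ = (c * (P ^ 2 * A + Q ^ 2 * B)) * (B * ‖a‖ ^ 2 + A * ‖b‖ ^ 2) := by ring
      _ ≤ _ := by gcongr
  have h3 : (A * B) * (c * ‖P • a + Q • b‖ ^ 2) ≤ (A * B) * (B * ‖a‖ ^ 2 + A * ‖b‖ ^ 2) := by
    linarith
  exact le_of_mul_le_mul_left h3 hAB

/-- The scalar inequality behind the choice `0.382`. -/
lemma aux_scalar {l t μ : ℝ} (hl : 0 ≤ l) (ht0 : 0 < t) (ht1 : t < 1) (hμ : 0 < μ)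
    (h : t ^ 2 * l ≤ μ) :
    l * (1 + t) * (l ^ 2 * t ^ 3 * (1 - t) + μ * (l + μ)) ≤ μ * (l + μ + l * t * (1 - t)) ^ 2 := by
  obtain ⟨d, rfl⟩ : ∃ d, μ = t ^ 2 * l + d := ⟨μ - t ^ 2 * l, by ring⟩
  have hd : 0 ≤ d := by linarith
  have h1t : 0 < 1 - t := by linarith
  have e : (t ^ 2 * l + d) * (l + (t ^ 2 * l + d) + l * t * (1 - t)) ^ 2 -
      l * (1 + t) * (l ^ 2 * t ^ 3 * (1 - t) + (t ^ 2 * l + d) * (l + (t ^ 2 * l + d))) =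
      (t ^ 2 * l + d) * (l * (1 + t) + d) * d + l ^ 2 * (1 + t) * t * (1 - t) * d := by ring
  have : 0 ≤ (t ^ 2 * l + d) * (l * (1 + t) + d) * d + l ^ 2 * (1 + t) * t * (1 - t) * d := by
    positivity
  linarith

lemma aux_quad {E : Type*} [NormedAddCommGroup E] [InnerProductSpace ℝ E] (X Xp xs : E)
    {σ τ l μ η : ℝ} (hσ : 0 < σ) (ht0 : 0 < τ) (ht1 : τ < 1) (hrec : τ ^ 2 = σ ^ 2 * (1 - τ))
    (hl : 0 ≤ l) (hμ : 0 < μ) (h : τ ^ 2 * l ≤ μ)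
    (hη : η = (1 - σ) * σ / (σ ^ 2 + ((l * (1 + τ) + μ) / (l + μ)) * τ)) :
    l * (1 + τ) * ‖((1 - τ) • X + τ • xs) - (X + η • (X - Xp))‖ ^ 2 ≤
      μ * (τ * (1 - τ)) * ‖xs - X‖ ^ 2 + (1 - τ) * (l + μ) * ‖((1 - σ) • Xp + σ • xs) - X‖ ^ 2 := by
  set D := l + μ + l * τ * (1 - τ) with hD
  have h1t : 0 < 1 - τ := by linarith
  have hDpos : 0 < D := by positivity
  have hA : 0 < l + μ := by positivity
  have hden : σ ^ 2 + ((l * (1 + τ) + μ) / (l + μ)) * τ = τ * D / ((l + μ) * (1 - τ)) := by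
    have : σ ^ 2 = τ ^ 2 / (1 - τ) := by field_simp; linarith
    rw [this, hD]
    field_simp
    ring
  set Q := σ * (l + μ) * (1 - τ) / (τ * D) with hQ
  set P := τ ^ 2 * l * (1 - τ) / D with hP
  have hη' : η = (1 - σ) * Q := by
    rw [hη, hden, hQ]
    field_simp
  have hP' : P = τ - Q * σ := by
    have : Q * σ = τ * (l + μ) / D := by
      rw [hQ]
      have : σ * (l + μ) * (1 - τ) / (τ * D) * σ = (σ ^ 2 * (1 - τ)) * (l + μ) / (τ * D) := by ring
      rw [this, ← hrec]
      field_simp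
    rw [this, hP]
    field_simp
    rw [hD]
    ring
  have hvec : ((1 - τ) • X + τ • xs) - (X + η • (X - Xp))
      = P • (xs - X) + Q • (((1 - σ) • Xp + σ • xs) - X) := by
    rw [hη', hP']
    module
  rw [hvec]
  apply aux_cs
  · positivity
  · positivity
  · positivity
  have hQ2 : Q ^ 2 = (l + μ) ^ 2 * (1 - τ) / D ^ 2 := by
    have : Q ^ 2 = (σ ^ 2 * (1 - τ)) * (l + μ) ^ 2 * (1 - τ) / (τ ^ 2 * D ^ 2) := by
      rw [hQ]; ring
    rw [this, ← hrec]
    field_simp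
  have key := aux_scalar hl ht0 ht1 hμ h
  rw [← hD] at key
  have e : l * (1 + τ) * (P ^ 2 * ((1 - τ) * (l + μ)) + Q ^ 2 * (μ * (τ * (1 - τ))))
      = (l * (1 + τ) * (l ^ 2 * τ ^ 3 * (1 - τ) + μ * (l + μ))) *
        ((1 - τ) ^ 2 * τ * (l + μ) / D ^ 2) := by
    rw [hQ2, hP]
    field_simp
  rw [e]
  calc _ ≤ (μ * D ^ 2) * ((1 - τ) ^ 2 * τ * (l + μ) / D ^ 2) := by gcongr
    _ = _ := by field_simp

/-- Theorem 2(b): primal objective residual bound of ASGARD+ when `f`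
is `μ_f`-strongly convex with `μ_f > 0`, `g*` is merely convex, and `g` is
`M_g`-Lipschitz continuous. For all `k ≥ 1`,
`F(x^k) - F⋆ ≤ 2‖K‖²‖x⁰-x⋆‖²/(β₀(k+1)²) + 10β₀(‖ẏ‖+M_g)²/(k+3)²`. -/
theorem stmt8 {p n : ℕ}
    (f : EuclideanSpace ℝ (Fin p) → ℝ) (Sf : Set (EuclideanSpace ℝ (Fin p)))
    (g : EuclideanSpace ℝ (Fin n) → ℝ)
    (gstar : EuclideanSpace ℝ (Fin n) → ℝ) (Sg : Set (EuclideanSpace ℝ (Fin n)))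
    (K : EuclideanSpace ℝ (Fin p) →L[ℝ] EuclideanSpace ℝ (Fin n))
    (hSf : Convex ℝ Sf) (hSg : Convex ℝ Sg)
    (hSfc : IsClosed Sf) (hSgc : IsClosed Sg)
    (μf : ℝ) (hμf : 0 < μf)
    -- `f` is `μ_f`-strongly convex, `g` and `g*` are merely convex
    (hf : ConvexOn ℝ Sf (fun x => f x - μf / 2 * ‖x‖ ^ 2))
    (hg : ConvexOn ℝ univ g) (hgstar : ConvexOn ℝ Sg gstar)
    -- `g*` is the Fenchel conjugate of `g` (on its domain `Sg`)
    (hconj : ∀ y ∈ Sg, IsLUB {r : ℝ | ∃ u, r = ⟪y, u⟫ - g u} (gstar y))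
    -- every subgradient of `g` belongs to `dom g* = Sg`
    (hsub : ∀ u v : EuclideanSpace ℝ (Fin n),
      (∀ w, g u + ⟪v, w - u⟫ ≤ g w) → v ∈ Sg)
    -- `g` is `M_g`-Lipschitz continuous
    (Mg : ℝ) (hMg : 0 ≤ Mg)
    (hgLip : ∀ u v : EuclideanSpace ℝ (Fin n), |g u - g v| ≤ Mg * ‖u - v‖)
    -- a saddle point of the Lagrangian exists
    (xs : EuclideanSpace ℝ (Fin p)) (ys : EuclideanSpace ℝ (Fin n))
    (hxs : xs ∈ Sf) (hys : ys ∈ Sg)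
    (hsaddle : ∀ x ∈ Sf, ∀ y ∈ Sg,
      f xs + ⟪K xs, y⟫ - gstar y ≤ f xs + ⟪K xs, ys⟫ - gstar ys ∧
      f xs + ⟪K xs, ys⟫ - gstar ys ≤ f x + ⟪K x, ys⟫ - gstar ys)
    -- parameters of ASGARD+
    (τ β L η : ℕ → ℝ)
    (hτ0 : τ 0 = 1)
    (hτ : ∀ k, τ (k + 1) = τ k / 2 * (Real.sqrt ((τ k) ^ 2 + 4) - τ k))
    (hβ0 : 0 < β 0) (hβ0' : β 0 ≥ 0.382 * ‖K‖ ^ 2 / μf)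
    (hβ : ∀ k, β (k + 1) = β k / (1 + τ (k + 1)))
    (hL : ∀ k, L k = ‖K‖ ^ 2 / β k)
    (hη : ∀ k, η (k + 1) =
      (1 - τ k) * τ k / ((τ k) ^ 2 + ((L (k + 1) + μf) / (L k + μf)) * τ (k + 1)))
    -- the iterates of ASGARD+
    (ydot : EuclideanSpace ℝ (Fin n))
    (x xhat : ℕ → EuclideanSpace ℝ (Fin p)) (yseq ytil : ℕ → EuclideanSpace ℝ (Fin n))
    (hx0 : x 0 ∈ Sf) (hxhat0 : xhat 0 = x 0) (hytil0 : ytil 0 ∈ Sg)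
    (hyup : ∀ k, yseq (k + 1) ∈ Sg ∧
      IsMaxOn (fun z => ⟪K (xhat k), z⟫ - gstar z - β k / 2 * ‖z - ydot‖ ^ 2) Sg
        (yseq (k + 1)))
    (hxup : ∀ k, x (k + 1) ∈ Sf ∧
      IsMinOn (fun z => f z + ⟪(ContinuousLinearMap.adjoint K) (yseq (k + 1)), z⟫ +
        L k / 2 * ‖z - xhat k‖ ^ 2) Sf (x (k + 1)))
    (hxhat : ∀ k, xhat (k + 1) = x (k + 1) + η (k + 1) • (x (k + 1) - x k))
    (hytil : ∀ k, ytil (k + 1) = (1 - τ k) • ytil k + τ k • yseq (k + 1)) :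
    ∀ k : ℕ, 1 ≤ k →
      (f (x k) + g (K (x k))) - (f xs + ⟪K xs, ys⟫ - gstar ys) ≤
        2 * ‖K‖ ^ 2 * ‖x 0 - xs‖ ^ 2 / (β 0 * ((k : ℝ) + 1) ^ 2) +
        10 * β 0 * (‖ydot‖ + Mg) ^ 2 / (((k : ℝ) + 3) ^ 2) := by
  have hτpos : ∀ k, 0 < τ k := by
    intro k
    induction k with
    | zero => rw [hτ0]; norm_num
    | succ k ih =>
      rw [hτ]
      have : τ k < Real.sqrt ((τ k) ^ 2 + 4) := Real.lt_sqrt_of_sq_lt (by linarith)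
      exact mul_pos (by linarith) (by linarith)
  have hrec : ∀ k, τ (k + 1) ^ 2 = τ k ^ 2 * (1 - τ (k + 1)) := by
    intro k
    rw [hτ]
    have hs := Real.sq_sqrt (show 0 ≤ (τ k) ^ 2 + 4 by positivity)
    set r := Real.sqrt ((τ k) ^ 2 + 4)
    linear_combination (τ k ^ 2 / 4) * hs
  have hτlt : ∀ k, τ (k + 1) < 1 := by
    intro k
    have h1 := hrec k
    have h2 : 0 < τ k ^ 2 * (1 - τ (k + 1)) := by rw [← h1]; exact pow_pos (hτpos _) 2
    have h3 := pos_of_mul_pos_right h2 (by positivity)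
    linarith
  have hτle : ∀ k, τ k ≤ 1 := by
    intro k
    cases k with
    | zero => rw [hτ0]
    | succ k => exact (hτlt k).le
  have hβpos : ∀ k, 0 < β k := by
    intro k
    induction k with
    | zero => exact hβ0
    | succ k ih => rw [hβ]; exact div_pos ih (by linarith [hτpos (k + 1)])
  -- inverses of the step sizes
  have hTrec : ∀ k, ((τ (k + 1))⁻¹) ^ 2 = (τ (k + 1))⁻¹ + ((τ k)⁻¹) ^ 2 := by
    intro k
    have := hτpos k
    have := hτpos (k + 1)
    field_simp
    linarith [hrec k]
  have hTpos : ∀ k, 0 < (τ k)⁻¹ := fun k => inv_pos.2 (hτpos k)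
  have hTlow : ∀ k : ℕ, ((k : ℝ) + 2) / 2 ≤ (τ k)⁻¹ := by
    intro k
    induction k with
    | zero => rw [hτ0]; norm_num
    | succ k ih =>
      have h1 := hTrec k
      have h2 := hTpos k
      have h3 := hTpos (k + 1)
      have : (τ k)⁻¹ + 1 / 2 ≤ (τ (k + 1))⁻¹ := by
        by_contra hc
        push Not at hc
        have : 1 ≤ (τ (k + 1))⁻¹ := (one_le_inv₀ (hτpos _)).2 (hτle _)
        nlinarith
      push_cast
      linarith
  have hβT : ∀ k, β k * (((τ k)⁻¹ + 1) ^ 2 + 1) ≤ 5 * β 0 := by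
    intro k
    induction k with
    | zero => rw [hτ0]; norm_num; linarith
    | succ k ih =>
      have h1 := hTrec k
      have h2 := hTpos k
      have h3 := hTpos (k + 1)
      have hb : β (k + 1) = β k * ((τ (k + 1))⁻¹ / ((τ (k + 1))⁻¹ + 1)) := by
        have := hτpos (k + 1)
        rw [hβ]
        field_simp
      have h4 : 3 / 2 ≤ (τ (k + 1))⁻¹ := by
        have := hTlow (k + 1)
        have : (0 : ℝ) ≤ k := k.cast_nonneg
        push_cast at *
        linarith
      set t := (τ (k + 1))⁻¹
      set s := (τ k)⁻¹
      have h5 : 2 * t ^ 2 + t - 2 ≤ 2 * (t + 1) * s := by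
        refine abs_le_of_sq_le_sq' ?_ (by positivity) |>.2
        have h8 : (2 * (t + 1) * s) ^ 2 = 4 * (t + 1) ^ 2 * (t ^ 2 - t) := by
          rw [mul_pow, mul_pow]
          have : s ^ 2 = t ^ 2 - t := by linarith
          rw [this]
          ring
        rw [h8]
        nlinarith
      have h6 : t * ((t + 1) ^ 2 + 1) ≤ (t + 1) * ((s + 1) ^ 2 + 1) := by nlinarith
      have h7 : t / (t + 1) * ((t + 1) ^ 2 + 1) ≤ (s + 1) ^ 2 + 1 := by
        rw [div_mul_eq_mul_div, div_le_iff₀ (by linarith)]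
        linarith
      calc β (k + 1) * ((t + 1) ^ 2 + 1) = β k * (t / (t + 1) * ((t + 1) ^ 2 + 1)) := by
            rw [hb]; ring
        _ ≤ β k * ((s + 1) ^ 2 + 1) := by
            exact mul_le_mul_of_nonneg_left h7 (hβpos k).le
        _ ≤ _ := ih
  have hLnn : ∀ k, 0 ≤ L k := by
    intro k
    rw [hL]
    exact div_nonneg (by positivity) (hβpos k).le
  have hLrec : ∀ k, L (k + 1) = L k * (1 + τ (k + 1)) := by
    intro k
    have h1 := hβpos k
    have h2 : 0 < 1 + τ (k + 1) := by linarith [hτpos (k + 1)]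
    rw [hL, hL, hβ]
    field_simp
  have hcond : ∀ k, τ (k + 1) ^ 2 * L k ≤ μf := by
    intro k
    induction k with
    | zero =>
      have h1 : τ 1 ^ 2 ≤ 0.382 := by
        have h := hrec 0
        have h2 := hτpos 1
        rw [hτ0] at h
        norm_num at h
        nlinarith
      have h2 : 0.382 * L 0 ≤ μf := by
        rw [hL]
        rw [ge_iff_le, div_le_iff₀ hμf] at hβ0'
        rw [← mul_div_assoc, div_le_iff₀ hβ0]
        linarith
      calc _ ≤ 0.382 * L 0 := mul_le_mul_of_nonneg_right h1 (hLnn 0)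
        _ ≤ _ := h2
    | succ k ih =>
      have ht := hτpos (k + 1)
      have ht' := hτpos (k + 1 + 1)
      have h1 : (1 - τ (k + 1 + 1)) * (1 + τ (k + 1)) ≤ 1 := by
        have h := hTrec (k + 1)
        have hp1 := hTpos (k + 1)
        have hp2 := hTpos (k + 1 + 1)
        have hle : (τ (k + 1 + 1))⁻¹ ≤ (τ (k + 1))⁻¹ + 1 := by
          by_contra hc
          push Not at hc
          nlinarith
        have : (τ (k + 1) * τ (k + 1 + 1)) * (τ (k + 1 + 1))⁻¹
          ≤ (τ (k + 1) * τ (k + 1 + 1)) * ((τ (k + 1))⁻¹ + 1) :=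
          mul_le_mul_of_nonneg_left hle (by positivity)
        have e1 : (τ (k + 1) * τ (k + 1 + 1)) * (τ (k + 1 + 1))⁻¹ = τ (k + 1) := by
          field_simp
        have e2 : (τ (k + 1) * τ (k + 1 + 1)) * ((τ (k + 1))⁻¹ + 1)
          = τ (k + 1 + 1) + τ (k + 1) * τ (k + 1 + 1) := by
          field_simp
        linarith
      rw [hrec (k + 1), hLrec k]
      have h0 : 0 ≤ τ (k + 1) ^ 2 * L k := mul_nonneg (by positivity) (hLnn k)
      calc _ = (τ (k + 1) ^ 2 * L k) * ((1 - τ (k + 1 + 1)) * (1 + τ (k + 1))) := by ring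
        _ ≤ (τ (k + 1) ^ 2 * L k) * 1 := mul_le_mul_of_nonneg_left h1 h0
        _ ≤ μf := by linarith
  have hxS : ∀ k, x k ∈ Sf := by
    intro k
    cases k with
    | zero => exact hx0
    | succ k => exact (hxup k).1
  set Fs := f xs + ⟪K xs, ys⟫ - gstar ys with hFs
  have hstep : ∀ k, ∀ w ∈ Sf, ∀ z ∈ Sg,
      f (x (k + 1)) + ⟪K (x (k + 1)), z⟫ - gstar z - β k / 2 * ‖z - ydot‖ ^ 2 ≤
      f w + ⟪K w, yseq (k + 1)⟫ - gstar (yseq (k + 1)) - β k / 2 * ‖yseq (k + 1) - ydot‖ ^ 2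
        + L k / 2 * ‖w - xhat k‖ ^ 2 - (L k + μf) / 2 * ‖w - x (k + 1)‖ ^ 2 := by
    intro k w hw z hz
    have h1 := (hxup k).2
    rw [hL] at h1 ⊢
    exact aux_step K (hβpos k) hSf hSg hf hgstar ydot (xhat k) (x (k + 1)) (yseq (k + 1))
      (hyup k).1 (hyup k).2 (hxup k).1 h1 w hw z hz
  have hmain : ∀ k, ∀ z ∈ Sg,
      f (x (k + 1)) + ⟪K (x (k + 1)), z⟫ - gstar z - β k / 2 * ‖z - ydot‖ ^ 2 - Fs
        + (L k + μf) / 2 * ‖((1 - τ k) • x k + τ k • xs) - x (k + 1)‖ ^ 2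
      ≤ τ k ^ 2 * (L 0 / 2 * ‖x 0 - xs‖ ^ 2) := by
    intro k
    induction k with
    | zero =>
      intro z hz
      have h1 := hstep 0 xs hxs z hz
      have h2 := (hsaddle xs hxs (yseq 1) (hyup 0).1).1
      rw [hτ0]
      have e : (1 - (1 : ℝ)) • x 0 + (1 : ℝ) • xs = xs := by simp
      rw [e]
      rw [hxhat0, norm_sub_rev xs (x 0)] at h1
      have h3 : 0 ≤ β 0 / 2 * ‖yseq (0 + 1) - ydot‖ ^ 2 := by positivity
      simp only [zero_add] at *
      linarith
    | succ k ih =>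
      intro z hz
      have ht0 := hτpos (k + 1)
      have ht1 := hτlt k
      have h1t : 0 ≤ 1 - τ (k + 1) := by linarith
      have hw : (1 - τ (k + 1)) • x (k + 1) + τ (k + 1) • xs ∈ Sf :=
        hSf (hxS _) hxs h1t ht0.le (by ring)
      have h1 := hstep (k + 1) _ hw z hz
      have h2 := (hsaddle xs hxs (yseq (k + 1 + 1)) (hyup (k + 1)).1).1
      have h3 := ih (yseq (k + 1 + 1)) (hyup (k + 1)).1
      have h4 := aux_strong hf (hxS (k + 1)) hxs ht0.le ht1.le
      have hη' := hη k
      rw [hLrec k] at hη'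
      have h5 := aux_quad (x (k + 1)) (x k) xs (hτpos k) ht0 ht1 (hrec k) (hLnn k) hμf (hcond k) hη'
      rw [← hLrec k, ← hxhat k] at h5
      have hbb : β k = β (k + 1) * (1 + τ (k + 1)) := by
        rw [hβ k]
        field_simp
      rw [hbb] at h3
      rw [map_add, map_smul, map_smul, inner_add_left, real_inner_smul_left,
        real_inner_smul_left] at h1
      rw [hrec k]
      have h2' := mul_le_mul_of_nonneg_left h2 ht0.le
      have h3' := mul_le_mul_of_nonneg_left h3 h1t
      have h6 : 0 ≤ β (k + 1) * τ (k + 1) ^ 2 * ‖yseq (k + 1 + 1) - ydot‖ ^ 2 := by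
        have := (hβpos (k + 1)).le
        positivity
      linarith [h1, h2', h3', h4, h5, h6]
  intro k hk
  obtain ⟨j, rfl⟩ : ∃ j, k = j + 1 := ⟨k - 1, by omega⟩
  have hcont : Continuous g := by
    have : LipschitzWith ⟨Mg, hMg⟩ g := LipschitzWith.of_dist_le_mul fun u v => by
      rw [Real.dist_eq, dist_eq_norm]
      exact hgLip u v
    exact this.continuous
  obtain ⟨v, hv⟩ := aux_subgrad g hg hcont (K (x (j + 1)))
  have hvS : v ∈ Sg := hsub _ v hv
  have hvn : ‖v‖ ≤ Mg := by
    have h1 := hv (K (x (j + 1)) + v)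
    have h2 := (le_abs_self _).trans (hgLip (K (x (j + 1)) + v) (K (x (j + 1))))
    rw [add_sub_cancel_left] at h1 h2
    rw [real_inner_self_eq_norm_sq] at h1
    by_contra hc
    push Not at hc
    nlinarith [norm_nonneg v]
  have hgv : gstar v ≤ ⟪K (x (j + 1)), v⟫ - g (K (x (j + 1))) := by
    apply (hconj v hvS).2
    rintro r ⟨u, rfl⟩
    have := hv u
    rw [inner_sub_right] at this
    rw [real_inner_comm v (K (x (j + 1)))]
    linarith
  have hfin := hmain j v hvS
  have hq : 0 ≤ (L j + μf) / 2 * ‖((1 - τ j) • x j + τ j • xs) - x (j + 1)‖ ^ 2 := by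
    have := hLnn j
    positivity
  have hnd : ‖v - ydot‖ ≤ ‖ydot‖ + Mg := by
    have := norm_sub_le v ydot
    linarith
  have hτj : τ j ^ 2 ≤ 4 / ((j : ℝ) + 2) ^ 2 := by
    have h1 := hTlow j
    have h2 := hτpos j
    have hj : (0 : ℝ) < (j : ℝ) + 2 := by positivity
    have h3 : τ j * ((j : ℝ) + 2) ≤ 2 := by
      have := mul_le_mul_of_nonneg_left h1 h2.le
      rw [mul_inv_cancel₀ h2.ne'] at this
      linarith
    rw [le_div_iff₀ (by positivity), ← mul_pow]
    have : 0 ≤ τ j * ((j : ℝ) + 2) := by positivity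
    nlinarith
  have hβj : β j ≤ 20 * β 0 / ((j : ℝ) + 4) ^ 2 := by
    have h1 := hTlow j
    have h2 := hβT j
    have hj : (0 : ℝ) ≤ (j : ℝ) := j.cast_nonneg
    have hb := hβpos j
    rw [le_div_iff₀ (by positivity)]
    have h3 : ((j : ℝ) + 4) ^ 2 ≤ 4 * (((τ j)⁻¹ + 1) ^ 2 + 1) := by nlinarith
    have := mul_le_mul_of_nonneg_left h3 hb.le
    linarith
  have hA : τ j ^ 2 * (L 0 / 2 * ‖x 0 - xs‖ ^ 2) ≤
      2 * ‖K‖ ^ 2 * ‖x 0 - xs‖ ^ 2 / (β 0 * (((j + 1 : ℕ) : ℝ) + 1) ^ 2) := by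
    have h0 : 0 ≤ L 0 / 2 * ‖x 0 - xs‖ ^ 2 := by
      have := hLnn 0
      positivity
    refine (mul_le_mul_of_nonneg_right hτj h0).trans (le_of_eq ?_)
    rw [hL]
    push_cast
    have : (j : ℝ) + 1 + 1 = j + 2 := by ring
    rw [this]
    field_simp
    ring
  have hB : β j / 2 * ‖v - ydot‖ ^ 2 ≤
      10 * β 0 * (‖ydot‖ + Mg) ^ 2 / ((((j + 1 : ℕ) : ℝ) + 3) ^ 2) := by
    have hb := hβpos j
    have e : 10 * β 0 * (‖ydot‖ + Mg) ^ 2 / ((((j + 1 : ℕ) : ℝ) + 3) ^ 2)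
        = (20 * β 0 / ((j : ℝ) + 4) ^ 2) / 2 * (‖ydot‖ + Mg) ^ 2 := by
      push_cast
      have : (j : ℝ) + 1 + 3 = j + 4 := by ring
      rw [this]
      ring
    rw [e]
    gcongr
  linarith
end

section
/- Assume f is μ_f-strongly convex with μ_f > 0, g* is merely convex (μ_{g*} = 0), a saddle point (x⋆, y⋆) of L exists, and f* is M_{f*}-Lipschitz continuous on dom f*. Run ASGARD+ with τ₀ := 1, β₀ ≥ 0.382‖K‖²/μ_f, τ_{k+1} := (τ_k/2)(√(τ_k² + 4) − τ_k), β_{k+1} := β_k/(1+τ_{k+1}), L_k := ‖K‖²/β_k, m_{k+1} := (L_{k+1}+μ_f)/(L_k+μ_f), η_{k+1} := (1−τ_k)τ_k/(τ_k² + m_{k+1}τ_{k+1}). Then for all k ≥ 1, D(ỹ^k) − D⋆ ≤ 2‖K‖²(‖x⁰‖ + M_{f*})²/(β₀(k+1)²) + 10β₀‖ẏ − y⋆‖²/(k+3)². -/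
open RealInnerProductSpace Set

lemma aux_norm_comb {E : Type*} [NormedAddCommGroup E] [InnerProductSpace ℝ E] (t : ℝ) (u z c : E) :
    ‖((1 - t) • u + t • z) - c‖ ^ 2 =
      (1 - t) * ‖u - c‖ ^ 2 + t * ‖z - c‖ ^ 2 - t * (1 - t) * ‖z - u‖ ^ 2 := by
  obtain ⟨a, rfl⟩ : ∃ a, u = a + c := ⟨u - c, by simp⟩
  obtain ⟨b, rfl⟩ : ∃ b, z = b + c := ⟨z - c, by simp⟩
  have h1 : ((1 - t) • (a + c) + t • (b + c)) - c = (1 - t) • a + t • b := by module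
  have h2 : b + c - (a + c) = b - a := by abel
  rw [h1, h2, add_sub_cancel_right, add_sub_cancel_right]
  simp only [← real_inner_self_eq_norm_sq, inner_add_left, inner_add_right, inner_sub_left,
    inner_sub_right, real_inner_smul_left, real_inner_smul_right, real_inner_comm a b]
  ring

lemma aux_prox {E : Type*} [NormedAddCommGroup E] [InnerProductSpace ℝ E]
    (S : Set E) (f : E → ℝ) (μ L : ℝ) (hμ : 0 ≤ μ) (hL : 0 ≤ L)
    (hf : ConvexOn ℝ S (fun x => f x - μ / 2 * ‖x‖ ^ 2)) (a c u : E) (hu : u ∈ S)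
    (hmin : ∀ z ∈ S, f u + ⟪a, u⟫ + L / 2 * ‖u - c‖ ^ 2 ≤ f z + ⟪a, z⟫ + L / 2 * ‖z - c‖ ^ 2)
    (z : E) (hz : z ∈ S) :
    f u + ⟪a, u⟫ + L / 2 * ‖u - c‖ ^ 2 + (L + μ) / 2 * ‖z - u‖ ^ 2 ≤
      f z + ⟪a, z⟫ + L / 2 * ‖z - c‖ ^ 2 := by
  have key : ∀ t : ℝ, 0 < t → t < 1 → (1 - t) * ((L + μ) / 2 * ‖z - u‖ ^ 2) ≤
      (f z + ⟪a, z⟫ + L / 2 * ‖z - c‖ ^ 2) - (f u + ⟪a, u⟫ + L / 2 * ‖u - c‖ ^ 2) := by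
    intro t ht0 ht1
    have hv := hf.1 hu hz (by linarith : (0:ℝ) ≤ 1 - t) ht0.le (by ring)
    have h1 := hmin _ hv
    have h2 := hf.2 hu hz (by linarith : (0:ℝ) ≤ 1 - t) ht0.le (by ring)
    have h3 := aux_norm_comb t u z c
    have h4 := aux_norm_comb t u z 0
    simp only [sub_zero, smul_eq_mul] at h4 h2
    rw [h4] at h2
    rw [h3, inner_add_right, real_inner_smul_right, real_inner_smul_right] at h1
    have : t * ((1 - t) * ((L + μ) / 2 * ‖z - u‖ ^ 2)) ≤
      t * ((f z + ⟪a, z⟫ + L / 2 * ‖z - c‖ ^ 2) - (f u + ⟪a, u⟫ + L / 2 * ‖u - c‖ ^ 2)) := by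
      linarith
    exact le_of_mul_le_mul_left this ht0
  have h0 := hmin z hz
  have hX : 0 ≤ (L + μ) / 2 * ‖z - u‖ ^ 2 := by positivity
  set X := (L + μ) / 2 * ‖z - u‖ ^ 2
  set Y := (f z + ⟪a, z⟫ + L / 2 * ‖z - c‖ ^ 2) - (f u + ⟪a, u⟫ + L / 2 * ‖u - c‖ ^ 2) with hY
  by_contra hcon
  have hXY : Y < X := by linarith
  have hY0 : 0 ≤ Y := by linarith
  have hXp : 0 < X := by linarith
  have hk := key ((X - Y) / (2 * X)) (by apply div_pos <;> linarith)
    (by rw [div_lt_one (by linarith)]; linarith)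
  have : (1 - (X - Y) / (2 * X)) * X = (X + Y) / 2 := by field_simp; ring
  linarith

lemma aux_quad_s9 {E : Type*} [NormedAddCommGroup E] [InnerProductSpace ℝ E]
    (a b c : ℝ) (ha : 0 ≤ a) (hc : 0 ≤ c) (hd : b ^ 2 ≤ a * c) (w e : E) :
    0 ≤ a * ‖w‖ ^ 2 - 2 * b * ⟪w, e⟫ + c * ‖e‖ ^ 2 := by
  rcases ha.eq_or_lt with h | h
  · subst h
    have : b = 0 := by nlinarith
    subst this
    nlinarith [sq_nonneg ‖e‖, mul_nonneg hc (sq_nonneg ‖e‖)]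
  · have h1 : 0 ≤ ‖a • w - b • e‖ ^ 2 := by positivity
    have h2 : ‖a • w - b • e‖ ^ 2 = a * (a * ‖w‖ ^ 2 - 2 * b * ⟪w, e⟫) + b ^ 2 * ‖e‖ ^ 2 := by
      simp only [← real_inner_self_eq_norm_sq, inner_sub_left,
        inner_sub_right, real_inner_smul_left, real_inner_smul_right, real_inner_comm w e]
      ring
    have h3 : b ^ 2 * ‖e‖ ^ 2 ≤ a * c * ‖e‖ ^ 2 := by gcongr
    have h4 : 0 ≤ a * (a * ‖w‖ ^ 2 - 2 * b * ⟪w, e⟫ + c * ‖e‖ ^ 2) := by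
      rw [h2] at h1; linarith
    exact nonneg_of_mul_nonneg_right h4 h

/-- the parameter inequality -/
lemma aux_param {E : Type*} [NormedAddCommGroup E] [InnerProductSpace ℝ E]
    (t l μ θ : ℝ) (ht : 0 < t) (ht1 : t ≤ 1) (hl : 0 ≤ l) (hμ : 0 < μ) (hc : t ^ 2 * l ≤ μ)
    (hθ : θ * ((1 + t) * l + μ - t ^ 2 * l) = l + μ) (w e : E) :
    l * (1 + t) * ‖w - θ • e‖ ^ 2 ≤ (l + μ) * ‖w - e‖ ^ 2 + μ * (1 - t) / t * ‖w‖ ^ 2 := by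
  obtain ⟨ν, rfl⟩ : ∃ ν, μ = t ^ 2 * l + ν := ⟨μ - t ^ 2 * l, by ring⟩
  have hν : 0 ≤ ν := by linarith
  set μ := t ^ 2 * l + ν with hμd
  set N := (1 + t) * l + ν with hN
  have hNp : 0 < N := by
    rcases hl.eq_or_lt with h | h
    · have : 0 < ν := by rw [hμd, ← h] at hμ; linarith
      positivity
    · positivity
  have hθ' : θ = (l + μ) / N := by
    rw [eq_div_iff hNp.ne', ← hθ]; congr 1; rw [hN, hμd]; ring
  have hq := aux_quad_s9 (E := E) ((l + μ) + μ * (1 - t) / t - l * (1 + t))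
    ((l + μ) - l * (1 + t) * θ) ((l + μ) - l * (1 + t) * θ ^ 2) ?_ ?_ ?_ w e
  · have e1 : ‖w - θ • e‖ ^ 2 = ‖w‖ ^ 2 - 2 * θ * ⟪w, e⟫ + θ ^ 2 * ‖e‖ ^ 2 := by
      simp only [← real_inner_self_eq_norm_sq, inner_sub_left,
        inner_sub_right, real_inner_smul_left, real_inner_smul_right, real_inner_comm w e]
      ring
    rw [e1, norm_sub_sq_real]
    linarith
  · have : (l + μ) + μ * (1 - t) / t - l * (1 + t) = ν / t := by
      rw [hμd]; field_simp; ring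
    rw [this]; positivity
  · have : (l + μ) - l * (1 + t) * θ ^ 2 = (l + μ) * (N ^ 2 - l * (1 + t) * (l + μ)) / N ^ 2 := by
      rw [hθ']; field_simp
    rw [this]
    apply div_nonneg _ (by positivity)
    apply mul_nonneg (by positivity)
    have : N ^ 2 - l * (1 + t) * (l + μ) =
        (1 + t) * l ^ 2 * (t * (1 - t)) + (1 + t) * l * ν + ν ^ 2 := by
      rw [hN, hμd]; ring
    rw [this]
    have : 0 ≤ 1 - t := by linarith
    positivity
  · have h1t : 0 ≤ 1 - t := by linarith
    have h1t3 : 0 ≤ 1 - t ^ 3 := by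
      have := pow_le_one₀ (n := 3) ht.le ht1
      linarith
    have : (l + μ + μ * (1 - t) / t - l * (1 + t)) * (l + μ - l * (1 + t) * θ ^ 2)
        - (l + μ - l * (1 + t) * θ) ^ 2 =
        (l + μ) / (t * N ^ 2) * ((1 + t) * (t * (1 - t)) * l ^ 2 * ν + (1 - t ^ 3) * l * ν ^ 2
          + (1 - t) * ν ^ 3) := by
      rw [hθ']
      field_simp
      rw [hN, hμd]
      ring
    have h2 : 0 ≤ (l + μ) / (t * N ^ 2) * ((1 + t) * (t * (1 - t)) * l ^ 2 * ν
          + (1 - t ^ 3) * l * ν ^ 2 + (1 - t) * ν ^ 3) := by positivity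
    linarith

/-- one-step geometry -/
lemma aux_geom {E : Type*} [NormedAddCommGroup E] [InnerProductSpace ℝ E]
    (s t l L μ η : ℝ) (hs : 0 < s) (ht : 0 < t) (ht1 : t ≤ 1) (hl : 0 ≤ l) (hμ : 0 < μ)
    (hL : L = l * (1 + t))
    (hc : t ^ 2 * l ≤ μ) (hst : t ^ 2 = s ^ 2 * (1 - t))
    (hη : η = (1 - s) * s / (s ^ 2 + (L + μ) / (l + μ) * t))
    (X x0 x1 x2 xh : E) (hxh : xh = x1 + η • (x1 - x0)) :
    (1 - t) * (L / 2 * ‖x1 - xh‖ ^ 2 - (L + μ) / 2 * ‖x1 - x2‖ ^ 2)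
      + t * (L / 2 * ‖X - xh‖ ^ 2 - (L + μ) / 2 * ‖X - x2‖ ^ 2)
      + (L + μ) / 2 * ‖((1 - t) • x1 + t • X) - x2‖ ^ 2
      ≤ (1 - t) * ((l + μ) / 2 * ‖((1 - s) • x0 + s • X) - x1‖ ^ 2) := by
  have hA : 0 < l + μ := by linarith
  have hLn : 0 ≤ L := by rw [hL]; positivity
  have h1t : 0 < 1 - t := by
    have : 0 < s ^ 2 * (1 - t) := by rw [← hst]; positivity
    exact pos_of_mul_pos_right this (by positivity)
  set D := (1 + t) * l + μ - t ^ 2 * l with hD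
  have hDp : 0 < D := by
    have : D = l * (1 + t * (1 - t)) + μ := by rw [hD]; ring
    rw [this]; positivity
  have hpar := aux_param t l μ ((l + μ) / D) ht ht1 hl hμ hc
    (by rw [← hD]; field_simp) (X - x1) (((1 - s) / s) • (x1 - x0))
  have hη' : η = t * ((l + μ) / D) * ((1 - s) / s) := by
    have hden : s ^ 2 + (L + μ) / (l + μ) * t = s ^ 2 * D / (t * (l + μ)) := by
      have : (L + μ) / (l + μ) * t = (t ^ 2 * (L + μ)) / (t * (l + μ)) := by field_simp
      rw [this, hst, hL, hD, eq_div_iff (by positivity), add_mul, div_mul_cancel₀ _ (by positivity)]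
      linear_combination (0:ℝ) * hst
    rw [hη, hden]
    field_simp
  have v1 := aux_norm_comb t x1 X xh
  have v2 := aux_norm_comb t x1 X x2
  have g1 : ((1 - t) • x1 + t • X) - xh
      = t • ((X - x1) - ((l + μ) / D) • (((1 - s) / s) • (x1 - x0))) := by
    rw [hxh, hη']; module
  have g2 : ((1 - s) • x0 + s • X) - x1 = s • ((X - x1) - ((1 - s) / s) • (x1 - x0)) := by
    rw [smul_sub s, smul_smul, mul_div_cancel₀ _ hs.ne']; module
  rw [g1, norm_smul, mul_pow, Real.norm_eq_abs, sq_abs] at v1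
  rw [g2, norm_smul, mul_pow, Real.norm_eq_abs, sq_abs]
  set P := ‖(X - x1) - ((l + μ) / D) • (((1 - s) / s) • (x1 - x0))‖ ^ 2
  set Q := ‖(X - x1) - ((1 - s) / s) • (x1 - x0)‖ ^ 2
  have hp2 : t ^ 2 * (l * (1 + t) * P) ≤ t ^ 2 * ((l + μ) * Q)
      + μ * (t * (1 - t)) * ‖X - x1‖ ^ 2 := by
    have := mul_le_mul_of_nonneg_left hpar (sq_nonneg t)
    have e : t ^ 2 * (μ * (1 - t) / t * ‖X - x1‖ ^ 2) = μ * (t * (1 - t)) * ‖X - x1‖ ^ 2 := by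
      field_simp
    linarith
  rw [← hL] at hp2
  have hgoal : (1 - t) * ((l + μ) / 2 * (s ^ 2 * Q)) = t ^ 2 * ((l + μ) * Q) / 2 := by
    rw [hst]; ring
  rw [hgoal, v2]
  have v1' : L * ((1 - t) * ‖x1 - xh‖ ^ 2 + t * ‖X - xh‖ ^ 2) =
     L * (t ^ 2 * P + t * (1 - t) * ‖X - x1‖ ^ 2) := by rw [v1]; ring
  linarith

lemma aux_tau_up (s t S T : ℝ) (hs : 0 ≤ s) (ht : 0 < t) (ht1 : t ≤ 1) (h : t ^ 2 = s ^ 2 * (1 - t))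
    (hS : s ≤ S) (hT : 0 < T) (hST : S ^ 2 * (1 - T) ≤ T ^ 2) : t ≤ T := by
  by_contra hc
  push Not at hc
  have h1 : s ^ 2 ≤ S ^ 2 := by gcongr
  have h2 : S ^ 2 * (1 - t) ≤ S ^ 2 * (1 - T) := by gcongr
  have h3 : s ^ 2 * (1 - t) ≤ S ^ 2 * (1 - t) := by
    apply mul_le_mul_of_nonneg_right h1; linarith
  nlinarith

lemma aux_tau (τ : ℕ → ℝ) (hτ0 : τ 0 = 1)
    (hτ : ∀ k, τ (k + 1) = τ k / 2 * (Real.sqrt ((τ k) ^ 2 + 4) - τ k)) :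
    (∀ k, 0 < τ k ∧ τ k ≤ 1) ∧ (∀ k, τ (k + 1) ^ 2 = τ k ^ 2 * (1 - τ (k + 1))) := by
  have hsq : ∀ k, τ (k + 1) ^ 2 = τ k ^ 2 * (1 - τ (k + 1)) := by
    intro k
    rw [hτ k]
    have := Real.sq_sqrt (show 0 ≤ τ k ^ 2 + 4 by positivity)
    linear_combination (τ k ^ 2 / 4) * this
  refine ⟨?_, hsq⟩
  intro k
  induction k with
  | zero => rw [hτ0]; norm_num
  | succ k ih =>
    have hp : 0 < τ (k + 1) := by
      rw [hτ k]
      have : τ k < Real.sqrt (τ k ^ 2 + 4) := Real.lt_sqrt_of_sq_lt (by linarith)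
      have h1 := ih.1
      have : 0 < Real.sqrt (τ k ^ 2 + 4) - τ k := by linarith
      positivity
    refine ⟨hp, ?_⟩
    by_contra hc
    push Not at hc
    have := hsq k
    have h2 : τ k ^ 2 * (1 - τ (k + 1)) ≤ 0 :=
      mul_nonpos_of_nonneg_of_nonpos (by positivity) (by linarith)
    nlinarith

lemma aux_tau_low (s t : ℝ) (hs : 0 < s) (ht : 0 < t) (h : t ^ 2 = s ^ 2 * (1 - t)) :
    s ≤ t * (1 + s) := by
  by_contra hc
  push Not at hc
  have h1 : (t * (1 + s)) ^ 2 < s ^ 2 := by gcongr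
  have h2 : s ^ 2 * ((1 - t) * (1 + s) ^ 2) < s ^ 2 * 1 := by
    have : (t * (1 + s)) ^ 2 = s ^ 2 * ((1 - t) * (1 + s) ^ 2) := by rw [mul_pow, h]; ring
    linarith
  have h3 := lt_of_mul_lt_mul_left h2 (by positivity)
  nlinarith

lemma aux_tau_bd (τ : ℕ → ℝ) (hτ0 : τ 0 = 1) (hp : ∀ k, 0 < τ k ∧ τ k ≤ 1)
    (hsq : ∀ k, τ (k + 1) ^ 2 = τ k ^ 2 * (1 - τ (k + 1))) (k : ℕ) :
    τ k ≤ 2 / ((k : ℝ) + 2) := by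
  induction k with
  | zero => rw [hτ0]; norm_num
  | succ k ih =>
    apply aux_tau_up (τ k) (τ (k + 1)) _ _ (hp k).1.le (hp _).1 (hp _).2 (hsq k) ih (by positivity)
    push_cast
    have hk : (0:ℝ) ≤ k := Nat.cast_nonneg k
    have : (2 / ((k:ℝ) + 1 + 2)) ^ 2 - (2 / ((k:ℝ) + 2)) ^ 2 * (1 - 2 / ((k:ℝ) + 1 + 2)) =
      4 / ((k + 3) ^ 2 * (k + 2) ^ 2) := by field_simp; ring
    have h2 : 0 ≤ 4 / (((k:ℝ) + 3) ^ 2 * (k + 2) ^ 2) := by positivity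
    linarith

lemma aux_beta (τ β : ℕ → ℝ) (hτ0 : τ 0 = 1) (hp : ∀ k, 0 < τ k ∧ τ k ≤ 1)
    (hsq : ∀ k, τ (k + 1) ^ 2 = τ k ^ 2 * (1 - τ (k + 1))) (hβ0 : 0 < β 0)
    (hβ : ∀ k, β (k + 1) = β k / (1 + τ (k + 1))) (k : ℕ) :
    β k ≤ 20 * β 0 / ((k : ℝ) + 4) ^ 2 := by
  have hβp : ∀ k, 0 < β k := by
    intro k
    induction k with
    | zero => exact hβ0
    | succ k ih => rw [hβ]; have := (hp (k + 1)).1; positivity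
  have hβ' : ∀ k, β k = β (k + 1) * (1 + τ (k + 1)) := by
    intro k; rw [hβ]; have := (hp (k + 1)).1; field_simp
  have l1 : 1 / 2 ≤ τ 1 := by
    have := aux_tau_low (τ 0) (τ 1) (hp 0).1 (hp 1).1 (hsq 0); rw [hτ0] at this; linarith
  have l2 : 1 / 3 ≤ τ 2 := by
    have := aux_tau_low (τ 1) (τ 2) (hp 1).1 (hp 2).1 (hsq 1)
    nlinarith [(hp 2).1, (hp 2).2]
  have u1 : τ 1 ≤ 0.6181 :=
    aux_tau_up (τ 0) (τ 1) 1 _ (hp 0).1.le (hp 1).1 (hp 1).2 (hsq 0) hτ0.le (by norm_num)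
      (by norm_num)
  have u2 : τ 2 ≤ 0.4561 :=
    aux_tau_up (τ 1) (τ 2) _ _ (hp 1).1.le (hp 2).1 (hp 2).2 (hsq 1) u1 (by norm_num)
      (by norm_num)
  have u3 : τ 3 ≤ 0.364 :=
    aux_tau_up (τ 2) (τ 3) _ _ (hp 2).1.le (hp 3).1 (hp 3).2 (hsq 2) u2 (by norm_num)
      (by norm_num)
  -- recursion for the ratio
  have hrec : ∀ k, β (k + 1) * (1 - τ (k + 1) ^ 2) * τ k ^ 2 = β k * τ (k + 1) ^ 2 := by
    intro k
    rw [hβ' k]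
    linear_combination (-β (k + 1) * (1 + τ (k + 1))) * hsq k
  have hbig : ∀ j : ℕ, β (j + 3) * (((j : ℝ) + 6) * (j + 7)) ≤
      5 * β 0 * (((j : ℝ) + 4) * (j + 5)) * τ (j + 3) ^ 2 := by
    intro j
    induction j with
    | zero =>
      have r0 := hrec 0
      have r1 := hrec 1
      have r2 := hrec 2
      simp only [zero_add, hτ0, one_pow, mul_one] at r0
      norm_num at r1 r2 ⊢
      have c1 : (0.6179:ℝ) ≤ 1 - τ 1 ^ 2 := by nlinarith
      have c2 : (0.7919:ℝ) ≤ 1 - τ 2 ^ 2 := by nlinarith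
      have c3 : (0.8675:ℝ) ≤ 1 - τ 3 ^ 2 := by nlinarith [(hp 3).1]
      have hprod : β 3 * ((1 - τ 1 ^ 2) * (1 - τ 2 ^ 2) * (1 - τ 3 ^ 2)) = β 0 * τ 3 ^ 2 := by
        have hne : τ 1 ^ 2 * τ 2 ^ 2 ≠ 0 := by
          have := (hp 1).1; have := (hp 2).1; positivity
        apply mul_right_cancel₀ hne
        linear_combination (1 - τ 1 ^ 2) * (1 - τ 2 ^ 2) * τ 1 ^ 2 * r2
          + (1 - τ 1 ^ 2) * τ 3 ^ 2 * r1 + τ 3 ^ 2 * τ 2 ^ 2 * r0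
      have hc : (0.42:ℝ) ≤ (1 - τ 1 ^ 2) * (1 - τ 2 ^ 2) * (1 - τ 3 ^ 2) := by
        calc (0.42:ℝ) ≤ 0.6179 * 0.7919 * 0.8675 := by norm_num
          _ ≤ _ := by gcongr
      have := mul_le_mul_of_nonneg_left hc (hβp 3).le
      rw [hprod] at this
      linarith
    | succ j ih =>
      have hr := hrec (j + 3)
      have hb := aux_tau_bd τ hτ0 hp hsq (j + 3 + 1)
      rw [show j + 1 + 3 = j + 3 + 1 from rfl]
      push_cast at hb ⊢
      have hj : (0:ℝ) ≤ j := Nat.cast_nonneg j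
      have hsb : τ (j + 3 + 1) ^ 2 ≤ 4 / ((j:ℝ) + 6) ^ 2 := by
        calc τ (j + 3 + 1) ^ 2 ≤ (2 / ((j:ℝ) + 3 + 1 + 2)) ^ 2 := by
              have := (hp (j + 3 + 1)).1; gcongr
          _ = 4 / ((j:ℝ) + 6) ^ 2 := by rw [div_pow]; norm_num; ring
      have hlow : ((j:ℝ) + 4) * (j + 8) / (j + 6) ^ 2 ≤ 1 - τ (j + 3 + 1) ^ 2 := by
        have : ((j:ℝ) + 4) * (j + 8) / (j + 6) ^ 2 = 1 - 4 / ((j:ℝ) + 6) ^ 2 := by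
          field_simp; ring
        linarith
      have hτp := (hp (j + 3)).1
      set B := β (j + 3 + 1)
      set C := β (j + 3)
      set T := τ (j + 3 + 1) ^ 2
      set R := τ (j + 3) ^ 2
      have hR : 0 < R := by positivity
      have hB : 0 < B := hβp _
      have hT : 0 ≤ T := by positivity
      have q1 : B * (((j:ℝ) + 4) * (j + 8) / (j + 6) ^ 2) * R ≤ C * T := by
        rw [← hr]; gcongr
      have q2 : C * T * (((j : ℝ) + 6) * (j + 7)) ≤
          5 * β 0 * (((j : ℝ) + 4) * (j + 5)) * R * T := by nlinarith
      have q3 : B * (((j:ℝ) + 4) * (j + 8) / (j + 6) ^ 2) * R * (((j : ℝ) + 6) * (j + 7))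
          ≤ 5 * β 0 * (((j : ℝ) + 4) * (j + 5)) * R * T :=
        le_trans (by gcongr) q2
      have q4 : B * (((j:ℝ) + 4) * (j + 8) / (j + 6) ^ 2) * R * (((j : ℝ) + 6) * (j + 7))
        = (R * (j + 4) / (j + 6)) * (B * ((j + 1 + 6) * (j + 1 + 7))) := by
        field_simp; ring
      have q5 : 5 * β 0 * (((j : ℝ) + 4) * (j + 5)) * R * T =
        (R * (j + 4) / (j + 6)) * (5 * β 0 * ((j + 1 + 4) * (j + 1 + 5)) * T) := by
        field_simp; ring
      rw [q4, q5] at q3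
      exact le_of_mul_le_mul_left q3 (by positivity)
  rcases k with _ | _ | _ | j
  · norm_num; linarith
  · have := hβ' 0
    simp only [zero_add] at this ⊢
    norm_num
    nlinarith [hβp 1]
  · have a := hβ' 0
    have b := hβ' 1
    simp only [zero_add, Nat.reduceAdd] at a b ⊢
    norm_num
    have : 2 ≤ (1 + τ 2) * (1 + τ 1) := by nlinarith
    have h2 := mul_le_mul_of_nonneg_left this (hβp 2).le
    rw [← mul_assoc, ← b, ← a] at h2
    linarith [hβp 2]
  · have h := hbig j
    have hb := aux_tau_bd τ hτ0 hp hsq (j + 3)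
    rw [show j + 1 + 1 + 1 = j + 3 from rfl]
    push_cast at hb ⊢
    have hsb : τ (j + 3) ^ 2 ≤ 4 / ((j:ℝ) + 5) ^ 2 := by
      calc τ (j + 3) ^ 2 ≤ (2 / ((j:ℝ) + 3 + 2)) ^ 2 := by
            have := (hp (j + 3)).1; gcongr
        _ = 4 / ((j:ℝ) + 5) ^ 2 := by rw [div_pow]; norm_num; ring
    have hj : (0:ℝ) ≤ j := Nat.cast_nonneg j
    have h2 : β (j + 3) * (((j : ℝ) + 6) * (j + 7)) ≤
      5 * β 0 * (((j : ℝ) + 4) * (j + 5)) * (4 / ((j:ℝ) + 5) ^ 2) := h.trans (by gcongr)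
    have h3 : 5 * β 0 * (((j : ℝ) + 4) * (j + 5)) * (4 / ((j:ℝ) + 5) ^ 2)
       = 20 * β 0 * (j + 4) / (j + 5) := by field_simp; ring
    rw [h3, le_div_iff₀ (by positivity)] at h2
    rw [le_div_iff₀ (by positivity)]
    have hB := hβp (j + 3)
    have h4 : β (j + 3) * ((j:ℝ) + 3 + 4) ^ 2 * (j + 4) ≤
        β (j + 3) * (((j : ℝ) + 6) * (j + 7)) * (j + 5) := by
      have : ((j:ℝ) + 3 + 4) ^ 2 * (j + 4) ≤ (((j : ℝ) + 6) * (j + 7)) * (j + 5) := by nlinarith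
      calc _ = β (j + 3) * (((j:ℝ) + 3 + 4) ^ 2 * (j + 4)) := by ring
        _ ≤ β (j + 3) * ((((j : ℝ) + 6) * (j + 7)) * (j + 5)) := by gcongr
        _ = _ := by ring
    exact le_of_mul_le_mul_right (h4.trans h2) (by positivity)

theorem stmt9 {p n : ℕ}
    (f : EuclideanSpace ℝ (Fin p) → ℝ) (Sf : Set (EuclideanSpace ℝ (Fin p)))
    (gstar : EuclideanSpace ℝ (Fin n) → ℝ) (Sg : Set (EuclideanSpace ℝ (Fin n)))
    (K : EuclideanSpace ℝ (Fin p) →L[ℝ] EuclideanSpace ℝ (Fin n))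
    (hSf : Convex ℝ Sf) (hSg : Convex ℝ Sg)
    (hSfc : IsClosed Sf) (hSgc : IsClosed Sg)
    (μf : ℝ) (hμf : 0 < μf)
    -- `f` is `μ_f`-strongly convex, `g*` is merely convex
    (hf : ConvexOn ℝ Sf (fun x => f x - μf / 2 * ‖x‖ ^ 2))
    (hgstar : ConvexOn ℝ Sg gstar)
    -- `f*` is the Fenchel conjugate of `f`; it is `M_{f*}`-Lipschitz (hence finite-valued)
    (fstar : EuclideanSpace ℝ (Fin p) → ℝ)
    (hfstar : ∀ w, IsLUB {r : ℝ | ∃ x' ∈ Sf, r = ⟪w, x'⟫ - f x'} (fstar w))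
    (Mf : ℝ) (hMf : 0 ≤ Mf)
    (hfLip : ∀ w w' : EuclideanSpace ℝ (Fin p), |fstar w - fstar w'| ≤ Mf * ‖w - w'‖)
    -- a saddle point of the Lagrangian exists
    (xs : EuclideanSpace ℝ (Fin p)) (ys : EuclideanSpace ℝ (Fin n))
    (hxs : xs ∈ Sf) (hys : ys ∈ Sg)
    (hsaddle : ∀ x ∈ Sf, ∀ y ∈ Sg,
      f xs + ⟪K xs, y⟫ - gstar y ≤ f xs + ⟪K xs, ys⟫ - gstar ys ∧
      f xs + ⟪K xs, ys⟫ - gstar ys ≤ f x + ⟪K x, ys⟫ - gstar ys)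
    -- parameters of ASGARD+
    (τ β L η : ℕ → ℝ)
    (hτ0 : τ 0 = 1)
    (hτ : ∀ k, τ (k + 1) = τ k / 2 * (Real.sqrt ((τ k) ^ 2 + 4) - τ k))
    (hβ0 : 0 < β 0) (hβ0' : β 0 ≥ 0.382 * ‖K‖ ^ 2 / μf)
    (hβ : ∀ k, β (k + 1) = β k / (1 + τ (k + 1)))
    (hL : ∀ k, L k = ‖K‖ ^ 2 / β k)
    (hη : ∀ k, η (k + 1) =
      (1 - τ k) * τ k / ((τ k) ^ 2 + ((L (k + 1) + μf) / (L k + μf)) * τ (k + 1)))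
    -- the iterates of ASGARD+
    (ydot : EuclideanSpace ℝ (Fin n))
    (x xhat : ℕ → EuclideanSpace ℝ (Fin p)) (yseq ytil : ℕ → EuclideanSpace ℝ (Fin n))
    (hx0 : x 0 ∈ Sf) (hxhat0 : xhat 0 = x 0) (hytil0 : ytil 0 ∈ Sg)
    (hyup : ∀ k, yseq (k + 1) ∈ Sg ∧
      IsMaxOn (fun z => ⟪K (xhat k), z⟫ - gstar z - β k / 2 * ‖z - ydot‖ ^ 2) Sg
        (yseq (k + 1)))
    (hxup : ∀ k, x (k + 1) ∈ Sf ∧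
      IsMinOn (fun z => f z + ⟪(ContinuousLinearMap.adjoint K) (yseq (k + 1)), z⟫ +
        L k / 2 * ‖z - xhat k‖ ^ 2) Sf (x (k + 1)))
    (hxhat : ∀ k, xhat (k + 1) = x (k + 1) + η (k + 1) • (x (k + 1) - x k))
    (hytil : ∀ k, ytil (k + 1) = (1 - τ k) • ytil k + τ k • yseq (k + 1)) :
    ∀ k : ℕ, 1 ≤ k →
      (fstar (-((ContinuousLinearMap.adjoint K) (ytil k))) + gstar (ytil k)) -
        (fstar (-((ContinuousLinearMap.adjoint K) ys)) + gstar ys) ≤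
        2 * ‖K‖ ^ 2 * (‖x 0‖ + Mf) ^ 2 / (β 0 * ((k : ℝ) + 1) ^ 2) +
        10 * β 0 * ‖ydot - ys‖ ^ 2 / (((k : ℝ) + 3) ^ 2) := by
  obtain ⟨hp, hsq⟩ := aux_tau τ hτ0 hτ
  have hβp : ∀ k, 0 < β k := by
    intro k
    induction k with
    | zero => exact hβ0
    | succ k ih => rw [hβ]; have := (hp (k + 1)).1; positivity
  have hLp : ∀ k, 0 ≤ L k := by
    intro k; rw [hL]; have := hβp k; positivity
  have hLrec : ∀ k, L (k + 1) = L k * (1 + τ (k + 1)) := by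
    intro k
    rw [hL, hL, hβ]
    have := hβp k
    have := (hp (k + 1)).1
    field_simp
  -- the condition on the strong convexity parameter
  have hcond : ∀ k, τ (k + 1) ^ 2 * L k ≤ μf := by
    intro k
    induction k with
    | zero =>
      have h1 : 0.382 * L 0 ≤ μf := by
        rw [hL, ← mul_div_assoc, div_le_iff₀ hβ0]
        have h := (div_le_iff₀ hμf).1 hβ0'
        linarith
      have h2 : τ (0 + 1) ^ 2 ≤ 0.382 := by
        have h := hsq 0
        have hpos := (hp (0 + 1)).1
        rw [hτ0] at h
        nlinarith
      exact (mul_le_mul_of_nonneg_right h2 (hLp 0)).trans h1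
    | succ k ih =>
      refine le_trans ?_ ih
      rw [hLrec k, hsq (k + 1)]
      have h1 := aux_tau_low _ _ (hp (k + 1)).1 (hp (k + 1 + 1)).1 (hsq (k + 1))
      have h2 : (1 - τ (k + 1 + 1)) * (1 + τ (k + 1)) ≤ 1 := by linarith
      have h3 := mul_le_mul_of_nonneg_left h2
        (mul_nonneg (sq_nonneg (τ (k + 1))) (hLp k))
      linarith
  -- the conjugate being Lipschitz, the domain of `f` is bounded
  have hbdd : ∀ X ∈ Sf, ‖X‖ ≤ Mf := by
    intro X hX
    by_contra hc
    push Not at hc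
    have hXp : 0 < ‖X‖ := lt_of_le_of_lt hMf hc
    have key : ∀ t : ℝ, 0 ≤ t → t * (‖X‖ * (‖X‖ - Mf)) ≤ fstar 0 + f X := by
      intro t ht
      have h1 : ⟪t • X, X⟫ - f X ≤ fstar (t • X) := (hfstar (t • X)).1 ⟨X, hX, rfl⟩
      have h2 := (abs_le.1 (hfLip (t • X) 0)).2
      rw [sub_zero, norm_smul, Real.norm_eq_abs, abs_of_nonneg ht] at h2
      rw [real_inner_smul_left, real_inner_self_eq_norm_sq] at h1
      linarith
    have hq : 0 < ‖X‖ * (‖X‖ - Mf) := mul_pos hXp (by linarith)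
    have h0 := key 0 le_rfl
    rw [zero_mul] at h0
    have h1 := key ((fstar 0 + f X + 1) / (‖X‖ * (‖X‖ - Mf)))
      (div_nonneg (by linarith) hq.le)
    rw [div_mul_cancel₀ _ hq.ne'] at h1
    linarith
  have hadj : ∀ (a : EuclideanSpace ℝ (Fin n)) (z : EuclideanSpace ℝ (Fin p)),
      ⟪(ContinuousLinearMap.adjoint K) a, z⟫ = ⟪K z, a⟫ := by
    intro a z
    rw [ContinuousLinearMap.adjoint_inner_left, real_inner_comm]
  -- one step
  have hstep : ∀ k, ∀ z ∈ Sf, ∀ y ∈ Sg,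
      f (x (k + 1)) + ⟪K (x (k + 1)), y⟫ - gstar y - β k / 2 * ‖y - ydot‖ ^ 2 ≤
      f z + ⟪K z, yseq (k + 1)⟫ - gstar (yseq (k + 1))
        - β k / 2 * ‖yseq (k + 1) - ydot‖ ^ 2 + (L k / 2 * ‖z - xhat k‖ ^ 2
        - (L k + μf) / 2 * ‖z - x (k + 1)‖ ^ 2) := by
    intro k z hz y hy
    have h1 := aux_prox Sf f μf (L k) hμf.le (hLp k) hf
      ((ContinuousLinearMap.adjoint K) (yseq (k + 1))) (xhat k) (x (k + 1)) (hxup k).1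
      (fun z hz => (hxup k).2 hz) z hz
    have h2 := aux_prox Sg gstar 0 (β k) le_rfl (hβp k).le (by simpa using hgstar)
      (-(K (xhat k))) ydot (yseq (k + 1)) (hyup k).1
      (fun z hz => by
        have := (hyup k).2 hz
        simp only [mem_setOf_eq] at this
        rw [inner_neg_left, inner_neg_left]
        linarith) y hy
    rw [hadj, hadj] at h1
    rw [inner_neg_left, inner_neg_left, add_zero] at h2
    have h3 : ⟪K (x (k + 1)) - K (xhat k), y - yseq (k + 1)⟫ ≤
        L k / 2 * ‖x (k + 1) - xhat k‖ ^ 2 + β k / 2 * ‖y - yseq (k + 1)‖ ^ 2 := by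
      rw [← map_sub]
      have c1 := real_inner_le_norm (K (x (k + 1) - xhat k)) (y - yseq (k + 1))
      have c2 := K.le_opNorm (x (k + 1) - xhat k)
      have c3 := mul_le_mul_of_nonneg_right c2 (norm_nonneg (y - yseq (k + 1)))
      set A := ‖x (k + 1) - xhat k‖
      set B := ‖y - yseq (k + 1)‖
      have hb := hβp k
      have c4 : L k / 2 * A ^ 2 + β k / 2 * B ^ 2 - ‖K‖ * A * B
          = (‖K‖ * A - β k * B) ^ 2 / (2 * β k) := by
        rw [hL]; field_simp; ring
      have c5 : 0 ≤ (‖K‖ * A - β k * B) ^ 2 / (2 * β k) := by positivity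
      linarith
    rw [inner_sub_left, inner_sub_right, inner_sub_right] at h3
    linarith
  have hytilS : ∀ k, ytil k ∈ Sg := by
    intro k
    induction k with
    | zero => exact hytil0
    | succ k ih =>
      rw [hytil]
      exact hSg ih (hyup k).1 (by linarith [(hp k).2]) (hp k).1.le (by ring)
  -- main induction
  have hmain : ∀ X ∈ Sf, ∀ k, ∀ y ∈ Sg,
      f (x (k + 1)) + ⟪K (x (k + 1)), y⟫ - gstar y - β k / 2 * ‖y - ydot‖ ^ 2
        - (f X + ⟪K X, ytil (k + 1)⟫ - gstar (ytil (k + 1)))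
        + (L k + μf) / 2 * ‖((1 - τ k) • x k + τ k • X) - x (k + 1)‖ ^ 2
      ≤ τ k ^ 2 * (L 0 / 2 * ‖X - x 0‖ ^ 2) := by
    intro X hX k
    induction k with
    | zero =>
      intro y hy
      have h := hstep 0 X hX y hy
      have hy1 : ytil (0 + 1) = yseq (0 + 1) := by rw [hytil, hτ0]; simp
      rw [hy1, hτ0]
      rw [hxhat0] at h
      simp only [sub_self, zero_smul, one_smul, zero_add] at h ⊢
      have : 0 ≤ β 0 / 2 * ‖yseq 1 - ydot‖ ^ 2 := by positivity
      linarith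
    | succ k ih =>
      intro y hy
      have hx1 := (hxup k).1
      have ht := (hp (k + 1)).1
      have ht1 := (hp (k + 1)).2
      have i0 := ih (yseq (k + 1 + 1)) (hyup (k + 1)).1
      have s1 := hstep (k + 1) (x (k + 1)) hx1 y hy
      have s2 := hstep (k + 1) X hX y hy
      have hg := aux_geom (τ k) (τ (k + 1)) (L k) (L (k + 1)) μf (η (k + 1)) (hp k).1 ht ht1
        (hLp k) hμf (hLrec k) (hcond k) (hsq k) (hη k) X (x k) (x (k + 1)) (x (k + 1 + 1))
        (xhat (k + 1)) (hxhat k)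
      have hgc := hgstar.2 (hytilS (k + 1)) (hyup (k + 1)).1
        (by linarith : (0:ℝ) ≤ 1 - τ (k + 1)) ht.le (by ring)
      rw [← hytil (k + 1)] at hgc
      simp only [smul_eq_mul] at hgc
      have hin : ⟪K X, ytil (k + 1 + 1)⟫ = (1 - τ (k + 1)) * ⟪K X, ytil (k + 1)⟫
          + τ (k + 1) * ⟪K X, yseq (k + 1 + 1)⟫ := by
        rw [hytil (k + 1), inner_add_right, real_inner_smul_right, real_inner_smul_right]
      have hbb : (1 - τ (k + 1)) * β k ≤ β (k + 1) := by
        have hb := hβp (k + 1)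
        have : β k = β (k + 1) * (1 + τ (k + 1)) := by rw [hβ]; field_simp
        rw [this]
        nlinarith [mul_pos hb (pow_pos ht 2)]
      have hbb2 := mul_le_mul_of_nonneg_right hbb
        (sq_nonneg ‖yseq (k + 1 + 1) - ydot‖)
      have h1t : 0 ≤ 1 - τ (k + 1) := by linarith
      have i0' := mul_le_mul_of_nonneg_left i0 h1t
      have s1' := mul_le_mul_of_nonneg_left s1 h1t
      have s2' := mul_le_mul_of_nonneg_left s2 ht.le
      rw [hin, hsq k]
      linarith
  -- conclusion
  intro k hk
  obtain ⟨j, rfl⟩ : ∃ j, k = j + 1 := ⟨k - 1, by omega⟩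
  have hDs : fstar (-((ContinuousLinearMap.adjoint K) ys)) ≤ -(f xs + ⟪K xs, ys⟫) := by
    apply (hfstar _).2
    rintro r ⟨z, hz, rfl⟩
    rw [inner_neg_left, hadj]
    have := (hsaddle z hz ys hys).2
    linarith
  have hDs' : -(f xs + ⟪K xs, ys⟫) ≤ fstar (-((ContinuousLinearMap.adjoint K) ys)) := by
    apply (hfstar _).1
    refine ⟨xs, hxs, ?_⟩
    rw [inner_neg_left, hadj]
    ring
  have hD : fstar (-((ContinuousLinearMap.adjoint K) (ytil (j + 1)))) ≤
      fstar (-((ContinuousLinearMap.adjoint K) ys)) + gstar ys - gstar (ytil (j + 1))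
      + (2 * ‖K‖ ^ 2 * (‖x 0‖ + Mf) ^ 2 / (β 0 * (((j + 1 : ℕ) : ℝ) + 1) ^ 2) +
        10 * β 0 * ‖ydot - ys‖ ^ 2 / ((((j + 1 : ℕ) : ℝ) + 3) ^ 2)) := by
    apply (hfstar _).2
    rintro r ⟨X, hX, rfl⟩
    rw [inner_neg_left, hadj]
    have h1 := hmain X hX j ys hys
    have h2 := (hsaddle (x (j + 1)) (hxup j).1 ys hys).2
    have h3 : 0 ≤ (L j + μf) / 2 * ‖((1 - τ j) • x j + τ j • X) - x (j + 1)‖ ^ 2 := by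
      have := hLp j; positivity
    have h4 : τ j ^ 2 * (L 0 / 2 * ‖X - x 0‖ ^ 2) ≤
        2 * ‖K‖ ^ 2 * (‖x 0‖ + Mf) ^ 2 / (β 0 * (((j + 1 : ℕ) : ℝ) + 1) ^ 2) := by
      have hb := aux_tau_bd τ hτ0 hp hsq j
      have hn : ‖X - x 0‖ ≤ ‖x 0‖ + Mf := by
        have := norm_sub_le X (x 0); have := hbdd X hX; linarith
      have hj := (hp j).1
      have hl := hLp 0
      calc τ j ^ 2 * (L 0 / 2 * ‖X - x 0‖ ^ 2)
          ≤ (2 / ((j:ℝ) + 2)) ^ 2 * (L 0 / 2 * (‖x 0‖ + Mf) ^ 2) := by gcongr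
        _ = _ := by rw [hL]; push_cast; field_simp; ring
    have h5 : β j / 2 * ‖ys - ydot‖ ^ 2 ≤
        10 * β 0 * ‖ydot - ys‖ ^ 2 / ((((j + 1 : ℕ) : ℝ) + 3) ^ 2) := by
      have hb := aux_beta τ β hτ0 hp hsq hβ0 hβ j
      rw [norm_sub_rev ys ydot]
      calc β j / 2 * ‖ydot - ys‖ ^ 2 ≤ (20 * β 0 / ((j : ℝ) + 4) ^ 2) / 2 * ‖ydot - ys‖ ^ 2 := by
            gcongr
        _ = _ := by push_cast; field_simp; ring
    linarith
  linarith
end
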